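/- Let $m \geq 1$, let $a \geq 1$ and $r$ be integers, and let $n \geq 0$ be an integer. Then $N^+(r, m, 2mn + a) = \sum_{k \geq n + \lceil (a - 2r)/(2m) \rceil} g(a - r + m(2n - k)) + \sum_{k \geq n + \lceil (a + 2r)/(2m) \rceil} g(a + r + m(2n - k))$, where each sum has only finitely many nonzero terms since $g(j) = 0$ for $j \leq 0$. -/

import Mathlib

/-- The Dyson rank of a partition: its largest part minus its number of parts. -/
def Nat.Partition.rank {n : ℕ} (l : n.Partition) : ℤ :=
  (l.parts.sup : ℤ) - l.parts.card

/-- `N⁺ r m n`: the number of partitions of `n` whose rank is congruent to `r` modulo `m`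
and has absolute value at least `n / 2` (`0` when `n` is not a positive integer). -/
noncomputable def rankCountPlus (r m n : ℤ) : ℕ :=
  if 0 < n then
    Nat.card {l : Nat.Partition n.toNat //
      l.rank ≡ r [ZMOD m] ∧ (n : ℚ) / 2 ≤ |(l.rank : ℚ)|}
  else 0

/-- `g k`: the number of partitions of `k` for which the number of parts occurs as a part
(`0` when `k` is not a positive integer). -/
noncomputable def g (k : ℤ) : ℕ :=
  if 0 < k then
    Nat.card {l : Nat.Partition k.toNat // (l.parts.card : ℕ) ∈ l.parts}
  else 0

namespace YoungDiagram

theorem sum_rowLens (μ : YoungDiagram) : μ.rowLens.sum = μ.card := by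
  have H : (μ.cells : Set (ℕ × ℕ)).MapsTo Prod.fst (Finset.range (μ.colLen 0)) := by
    rintro ⟨i, j⟩ h
    simpa [← mem_iff_lt_colLen] using μ.up_left_mem le_rfl (Nat.zero_le j) h
  rw [YoungDiagram.card, Finset.card_eq_sum_card_fiberwise H, rowLens,
    ← Multiset.sum_coe, ← Multiset.map_coe]
  exact Finset.sum_congr (s₁ := Finset.range (μ.colLen 0)) rfl fun i _ => μ.rowLen_eq_card

theorem card_transpose (μ : YoungDiagram) : μ.transpose.card = μ.card := by
  simp [YoungDiagram.card, transpose]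

theorem sup_rowLens (μ : YoungDiagram) : (μ.rowLens : Multiset ℕ).sup = μ.rowLen 0 := by
  refine le_antisymm (Multiset.sup_le.2 fun b hb => ?_) ?_
  · obtain ⟨i, -, rfl⟩ := List.mem_map.1 (Multiset.mem_coe.1 hb)
    exact μ.rowLen_anti 0 i (Nat.zero_le i)
  · rcases Nat.eq_zero_or_pos (μ.rowLen 0) with h | h
    · simp [h]
    · refine Multiset.le_sup (Multiset.mem_coe.2 (List.mem_map.2 ⟨0, ?_, rfl⟩))
      rwa [List.mem_range, ← mem_iff_lt_colLen, mem_iff_lt_rowLen]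

end YoungDiagram

namespace Nat.Partition

/-- The Young diagram of a partition. -/
def toYoungDiagram {n : ℕ} (l : n.Partition) : YoungDiagram :=
  YoungDiagram.ofRowLens (l.parts.sort (· ≥ ·)) (Multiset.pairwise_sort _ _).sortedGE

theorem rowLens_toYoungDiagram {n : ℕ} (l : n.Partition) :
    l.toYoungDiagram.rowLens = l.parts.sort (· ≥ ·) :=
  YoungDiagram.rowLens_ofRowLens_eq_self fun _ hx =>
    l.parts_pos ((Multiset.mem_sort _).1 hx)

theorem coe_rowLens_toYoungDiagram {n : ℕ} (l : n.Partition) :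
    (l.toYoungDiagram.rowLens : Multiset ℕ) = l.parts := by
  rw [rowLens_toYoungDiagram, Multiset.sort_eq]

theorem card_toYoungDiagram {n : ℕ} (l : n.Partition) : l.toYoungDiagram.card = n := by
  rw [← YoungDiagram.sum_rowLens, ← Multiset.sum_coe, coe_rowLens_toYoungDiagram, l.parts_sum]

/-- The conjugate partition, obtained by transposing the Young diagram. -/
def conj {n : ℕ} (l : n.Partition) : n.Partition where
  parts := l.toYoungDiagram.transpose.rowLens
  parts_pos hi := YoungDiagram.pos_of_mem_rowLens _ _ hi
  parts_sum := by
    rw [Multiset.sum_coe, YoungDiagram.sum_rowLens, YoungDiagram.card_transpose,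
      card_toYoungDiagram]

theorem toYoungDiagram_conj {n : ℕ} (l : n.Partition) :
    l.conj.toYoungDiagram = l.toYoungDiagram.transpose := by
  apply YoungDiagram.equivListRowLens.injective
  refine Subtype.ext ?_
  refine List.Perm.eq_of_sortedGE (YoungDiagram.rowLens_sorted _)
    (YoungDiagram.rowLens_sorted _) ?_
  exact Multiset.coe_eq_coe.1 l.conj.coe_rowLens_toYoungDiagram

theorem conj_involutive {n : ℕ} : Function.Involutive (conj : n.Partition → n.Partition) := by
  intro l
  refine Partition.ext ?_
  change (l.conj.toYoungDiagram.transpose.rowLens : Multiset ℕ) = l.parts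
  rw [toYoungDiagram_conj, YoungDiagram.transpose_transpose, coe_rowLens_toYoungDiagram]

theorem rank_conj {n : ℕ} (l : n.Partition) : l.conj.rank = -l.rank := by
  rw [rank, rank, ← coe_rowLens_toYoungDiagram l, YoungDiagram.sup_rowLens, conj,
    YoungDiagram.sup_rowLens, YoungDiagram.rowLen_transpose]
  simp

theorem sup_mem_parts {n : ℕ} (hn : 0 < n) (l : n.Partition) : l.parts.sup ∈ l.parts := by
  have h0 : l.parts ≠ 0 := by
    intro h
    have := l.parts_sum
    simp [h] at this
    omega
  obtain ⟨a, ha, hmax⟩ := Finset.exists_max_image l.parts.toFinset id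
    (by simpa [Finset.nonempty_iff_ne_empty] using h0)
  rw [le_antisymm (Multiset.sup_le.2 fun b hb => hmax b (by simpa using hb))
    (Multiset.le_sup (by simpa using ha))]
  simpa using ha

theorem rank_lt {n : ℕ} (hn : 0 < n) (l : n.Partition) : l.rank < n := by
  have h1 := l.sup_mem_parts hn
  have h2 := le_of_mem_parts h1
  have h3 : 0 < l.parts.card := Multiset.card_pos_iff_exists_mem.2 ⟨_, h1⟩
  rw [rank]
  omega

/-- Replace an occurrence of the part `a` by the positive part `b`. -/
def replacePart {n : ℕ} (l : n.Partition) {k : ℕ} (a b : ℕ) (ha : a ∈ l.parts) (hb : 0 < b)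
    (h : n + b = k + a) : k.Partition where
  parts := b ::ₘ l.parts.erase a
  parts_pos hi := by
    rcases Multiset.mem_cons.1 hi with rfl | hi
    · exact hb
    · exact l.parts_pos (Multiset.mem_of_mem_erase hi)
  parts_sum := by
    have h1 := congrArg Multiset.sum (Multiset.cons_erase ha)
    rw [Multiset.sum_cons, l.parts_sum] at h1
    rw [Multiset.sum_cons]
    omega

theorem card_replacePart {n : ℕ} (l : n.Partition) {k : ℕ} (a b : ℕ) (ha : a ∈ l.parts)
    (hb : 0 < b) (h : n + b = k + a) :
    (l.replacePart a b ha hb h).parts.card = l.parts.card := by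
  rw [replacePart, Multiset.card_cons, Multiset.card_erase_add_one ha]

theorem sup_replacePart {n : ℕ} (l : n.Partition) {k : ℕ} (a b : ℕ) (ha : a ∈ l.parts)
    (hb : 0 < b) (h : n + b = k + a) (hab : n ≤ a + b) :
    (l.replacePart a b ha hb h).parts.sup = b := by
  rw [replacePart, Multiset.sup_cons, sup_eq_left]
  refine Multiset.sup_le.2 fun c hc => ?_
  have h1 := congrArg Multiset.sum (Multiset.cons_erase ha)
  rw [Multiset.sum_cons, l.parts_sum] at h1
  have := Multiset.le_sum_of_mem hc
  omega

/-- Lowering the largest part of a partition of `k + ρ` of rank `ρ ≥ k` by `ρ` gives a partition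
of `k` whose number of parts is a part. -/
def rankEquiv {k ρ : ℕ} (hk : 0 < k) (h : k ≤ ρ) :
    {l : (k + ρ).Partition // l.rank = ρ} ≃ {l : k.Partition // l.parts.card ∈ l.parts} where
  toFun l := ⟨l.1.replacePart l.1.parts.sup l.1.parts.card (l.1.sup_mem_parts (by omega))
      (Multiset.card_pos_iff_exists_mem.2 ⟨_, l.1.sup_mem_parts (by omega)⟩)
      (by have := l.2; rw [rank] at this; omega), by
    rw [card_replacePart]
    exact Multiset.mem_cons_self _ _⟩
  invFun l := ⟨l.1.replacePart l.1.parts.card (l.1.parts.card + ρ) l.2 (by omega) (by omega), by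
    rw [rank, card_replacePart, sup_replacePart _ _ _ _ _ _ (by omega)]
    omega⟩
  left_inv l := by
    refine Subtype.ext (Partition.ext ?_)
    have hl := l.2
    rw [rank] at hl
    have hs : l.1.parts.card + ρ = l.1.parts.sup := by omega
    simp only [card_replacePart]
    simp only [replacePart, Multiset.erase_cons_head, hs]
    exact Multiset.cons_erase (l.1.sup_mem_parts (by omega))
  right_inv l := by
    refine Subtype.ext (Partition.ext ?_)
    have hs := sup_replacePart l.1 (k := k + ρ) l.1.parts.card (l.1.parts.card + ρ) l.2
      (by omega) (by omega) (by omega)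
    have hc := card_replacePart l.1 (k := k + ρ) l.1.parts.card (l.1.parts.card + ρ) l.2
      (by omega) (by omega)
    simp only [replacePart] at hs hc ⊢
    simp only [hs, hc, Multiset.erase_cons_head]
    exact Multiset.cons_erase l.2

theorem card_rank_eq {N : ℕ} (hN : 0 < N) {ρ : ℤ} (h : (N : ℤ) ≤ 2 * ρ) :
    Nat.card {l : N.Partition // l.rank = ρ} = g (N - ρ) := by
  lift ρ to ℕ using by omega
  rw [g]
  split_ifs with hk
  · obtain ⟨k, rfl⟩ := Nat.exists_eq_add_of_le' (show ρ ≤ N by omega)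
    rw [Nat.card_congr (rankEquiv (by omega) (by omega))]
    have : ((k + ρ : ℕ) - ρ : ℤ).toNat = k := by omega
    rw [this]
  · have : IsEmpty {l : N.Partition // l.rank = ρ} :=
      ⟨fun l => by have := l.1.rank_lt hN; have := l.2; omega⟩
    exact Nat.card_of_isEmpty

theorem card_rank_modEq {N : ℕ} (hN : 0 < N) {m : ℤ} (hm : 1 ≤ m) (r c : ℤ)
    (hc : ∀ k, c ≤ k ↔ (N : ℤ) ≤ 2 * (r + m * k)) :
    Nat.card {l : N.Partition // l.rank ≡ r [ZMOD m] ∧ (N : ℤ) ≤ 2 * l.rank}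
      = ∑ᶠ (k : ℤ) (_ : c ≤ k), g (N - (r + m * k)) := by
  classical
  have key : ∀ l : N.Partition, l.rank ≡ r [ZMOD m] → ∀ k,
      ((l.rank - r) / m = k ↔ l.rank = r + m * k) := by
    intro l hl k
    obtain ⟨d, hd⟩ := hl.symm.dvd
    have h1 : l.rank = r + m * d := by linarith
    have h2 : (l.rank - r) / m = d := by
      rw [hd, Int.mul_ediv_cancel_left _ (by omega)]
    rw [h2, h1]
    constructor
    · rintro rfl
      rfl
    · intro h
      exact mul_left_cancel₀ (show m ≠ 0 by omega) (by linarith)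
  have hfib : ∀ k, c ≤ k → g (N - (r + m * k)) =
      (Finset.univ.filter fun l : N.Partition => l.rank = r + m * k).card := by
    intro k hk
    rw [← card_rank_eq hN ((hc k).1 hk), Nat.card_eq_fintype_card, Fintype.card_subtype]
  rw [Nat.card_eq_fintype_card, Fintype.card_subtype,
    Finset.card_eq_sum_card_image (fun l : N.Partition => (l.rank - r) / m)]
  set S := Finset.univ.filter fun l : N.Partition =>
    l.rank ≡ r [ZMOD m] ∧ (N : ℤ) ≤ 2 * l.rank with hS
  have hmem : ∀ k ∈ S.image (fun l : N.Partition => (l.rank - r) / m), c ≤ k := by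
    intro k hk
    obtain ⟨l, hl, hlk⟩ := Finset.mem_image.1 hk
    simp only [hS, Finset.mem_filter, Finset.mem_univ, true_and] at hl
    rw [hc, ← (key l hl.1 k).1 hlk]
    exact hl.2
  have hmod : ∀ k, r + m * k ≡ r [ZMOD m] := fun k => by simp [Int.ModEq]
  symm
  have hsum := finsum_mem_eq_sum_of_inter_support_eq (fun k : ℤ => g (N - (r + m * k)))
    (s := {k | c ≤ k}) (t := S.image (fun l : N.Partition => (l.rank - r) / m)) ?_
  · refine hsum.trans (Finset.sum_congr rfl fun k hk => ?_)
    rw [hfib k (hmem k hk)]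
    congr 1
    ext l
    simp only [hS, Finset.mem_filter, Finset.mem_univ, true_and]
    constructor
    · intro h
      have h1 : l.rank ≡ r [ZMOD m] := h ▸ hmod k
      exact ⟨⟨h1, h ▸ (hc k).1 (hmem k hk)⟩, (key l h1 k).2 h⟩
    · rintro ⟨⟨h1, -⟩, h2⟩
      exact (key l h1 k).1 h2
  · ext k
    refine and_congr_left fun hk => ⟨fun hck => ?_, fun h => hmem k h⟩
    have hk' : g (N - (r + m * k)) ≠ 0 := hk
    rw [hfib k hck, Finset.card_ne_zero] at hk'
    obtain ⟨l, hl⟩ := hk'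
    simp only [Finset.mem_filter, Finset.mem_univ, true_and] at hl
    have h1 : l.rank ≡ r [ZMOD m] := hl ▸ hmod k
    refine Finset.mem_coe.2 (Finset.mem_image.2 ⟨l, ?_, (key l h1 k).2 hl⟩)
    simp only [hS, Finset.mem_filter, Finset.mem_univ, true_and]
    exact ⟨h1, hl ▸ (hc k).1 hck⟩

theorem card_rank_modEq_neg (N : ℕ) (m r : ℤ) :
    Nat.card {l : N.Partition // l.rank ≡ r [ZMOD m] ∧ (N : ℤ) ≤ -(2 * l.rank)}
      = Nat.card {l : N.Partition // l.rank ≡ -r [ZMOD m] ∧ (N : ℤ) ≤ 2 * l.rank} := by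
  refine Nat.card_congr (conj_involutive.toPerm.subtypeEquiv fun l => ?_)
  rw [Function.Involutive.coe_toPerm, rank_conj, mul_neg]
  exact and_congr_left' ⟨fun h => h.neg, fun h => by simpa using h.neg⟩

theorem card_rank_modEq_abs {N : ℕ} (hN : 0 < N) (m r : ℤ) :
    Nat.card {l : N.Partition // l.rank ≡ r [ZMOD m] ∧ (N : ℤ) ≤ 2 * |l.rank|}
      = Nat.card {l : N.Partition // l.rank ≡ r [ZMOD m] ∧ (N : ℤ) ≤ 2 * l.rank}
        + Nat.card {l : N.Partition // l.rank ≡ r [ZMOD m] ∧ (N : ℤ) ≤ -(2 * l.rank)} := by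
  classical
  simp only [Nat.card_eq_fintype_card, Fintype.card_subtype]
  rw [← Finset.card_union_of_disjoint]
  · congr 1
    ext l
    simp only [Finset.mem_union, Finset.mem_filter, Finset.mem_univ, true_and, ← and_or_left]
    refine and_congr_right fun _ => ?_
    rcases abs_cases l.rank with h | h <;> omega
  · refine Finset.disjoint_left.2 fun l h1 h2 => ?_
    simp only [Finset.mem_filter, Finset.mem_univ, true_and] at h1 h2
    omega

end Nat.Partition

theorem add_ceil_div_le_iff {m : ℤ} (hm : 1 ≤ m) (a r n k : ℤ) :
    n + ⌈((a : ℚ) - 2 * r) / (2 * m)⌉ ≤ k ↔ 2 * m * n + a ≤ 2 * (r + m * k) := by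
  have hm' : (0 : ℚ) < 2 * m := by
    have : (1 : ℚ) ≤ m := by exact_mod_cast hm
    linarith
  rw [← le_sub_iff_add_le', Int.ceil_le, div_le_iff₀ hm', ← Int.cast_le (R := ℚ)]
  push_cast
  constructor <;> intro h <;> linarith

theorem rankCountPlus_eq_finsum (m a r : ℤ) (hm : 1 ≤ m) (ha : 1 ≤ a)
    (n : ℤ) (hn : 0 ≤ n) :
    rankCountPlus r m (2 * m * n + a)
      = (∑ᶠ (k : ℤ) (_ : n + ⌈((a : ℚ) - 2 * r) / (2 * m)⌉ ≤ k),
          g (a - r + m * (2 * n - k)))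
        + (∑ᶠ (k : ℤ) (_ : n + ⌈((a : ℚ) + 2 * r) / (2 * m)⌉ ≤ k),
          g (a + r + m * (2 * n - k))) := by
  have hmn : 0 ≤ 2 * m * n := by positivity
  obtain ⟨N, hN⟩ : ∃ N : ℕ, (N : ℤ) = 2 * m * n + a := ⟨_, Int.toNat_of_nonneg (by omega)⟩
  have hpos : 0 < N := by omega
  have habs : ∀ l : N.Partition,
      (((N : ℤ) : ℚ) / 2 ≤ |(l.rank : ℚ)| ↔ (N : ℤ) ≤ 2 * |l.rank|) := by
    intro l
    rw [div_le_iff₀ two_pos, mul_comm]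
    exact_mod_cast Iff.rfl
  rw [rankCountPlus, ← hN, if_pos (by omega), Int.toNat_natCast]
  simp only [habs]
  rw [Nat.Partition.card_rank_modEq_abs hpos, Nat.Partition.card_rank_modEq_neg,
    Nat.Partition.card_rank_modEq hpos hm r (n + ⌈((a : ℚ) - 2 * r) / (2 * m)⌉)
      fun k => by rw [hN, add_ceil_div_le_iff hm],
    Nat.Partition.card_rank_modEq hpos hm (-r) (n + ⌈((a : ℚ) + 2 * r) / (2 * m)⌉)
      fun k => by
        rw [hN, ← add_ceil_div_le_iff hm]
        push_cast
        rw [mul_neg, sub_neg_eq_add]]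
  have h1 : ∀ k, (N : ℤ) - (r + m * k) = a - r + m * (2 * n - k) := fun k => by rw [hN]; ring
  have h2 : ∀ k, (N : ℤ) - (-r + m * k) = a + r + m * (2 * n - k) := fun k => by rw [hN]; ring
  simp only [h1, h2]
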